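/- Let T be a subsystem of a Lie triple system S over a field F and let s ∈ S. Then (T:s) is an ideal of T. Moreover, (T:s) is maximal among the ideals I of T such that [I,T,s] + [I,s,T] ⊆ T, i.e., every ideal I of T with [I,T,s] + [I,s,T] ⊆ T satisfies I ⊆ (T:s). -/

import Mathlib

/-- A Lie triple system structure on an `F`-vector space `S`:
a trilinear map `b` satisfying `[x,x,z] = 0`, the cyclic identity and the
Leibniz (derivation) identity. -/
structure LTSStruct (F : Type*) (S : Type*) [Field F] [AddCommGroup S] [Module F S] where
  b : S → S → S → S
  add₁ : ∀ x x' y z, b (x + x') y z = b x y z + b x' y z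
  smul₁ : ∀ (c : F) (x y z : S), b (c • x) y z = c • b x y z
  add₂ : ∀ x y y' z, b x (y + y') z = b x y z + b x y' z
  smul₂ : ∀ (c : F) (x y z : S), b x (c • y) z = c • b x y z
  add₃ : ∀ x y z z', b x y (z + z') = b x y z + b x y z'
  smul₃ : ∀ (c : F) (x y z : S), b x y (c • z) = c • b x y z
  alt : ∀ x z, b x x z = 0
  cyclic : ∀ x y z, b x y z + b y z x + b z x y = 0
  leibniz : ∀ u v x y z,
    b u v (b x y z) = b (b u v x) y z + b x (b u v y) z + b x y (b u v z)

namespace LTSStruct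

variable {F : Type*} [Field F] {S : Type*} [AddCommGroup S] [Module F S]

/-- `I` is an ideal of the whole Lie triple system `S`: `[I,S,S] ⊆ I`. -/
def IsIdeal (L : LTSStruct F S) (I : Submodule F S) : Prop :=
  ∀ x ∈ I, ∀ y z : S, L.b x y z ∈ I

/-- `T` is a subsystem of `S`: `[T,T,T] ⊆ T`. -/
def IsSubsystem (L : LTSStruct F S) (T : Submodule F S) : Prop :=
  ∀ x ∈ T, ∀ y ∈ T, ∀ z ∈ T, L.b x y z ∈ T

/-- `I` is an ideal of the subsystem `T`: `I ⊆ T` and `[I,T,T] ⊆ I`. -/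
def IsIdealOf (L : LTSStruct F S) (I T : Submodule F S) : Prop :=
  I ≤ T ∧ ∀ x ∈ I, ∀ y ∈ T, ∀ z ∈ T, L.b x y z ∈ I

/-- The centralizer of a subset `I` in the whole system `S`:
`C_S(I) = {x ∈ S : [x,I,S] = [S,I,x] = 0}`. -/
def centralizer (L : LTSStruct F S) (I : Set S) : Set S :=
  {x | (∀ i ∈ I, ∀ t : S, L.b x i t = 0) ∧ (∀ t : S, ∀ i ∈ I, L.b t i x = 0)}

/-- The centralizer of a subset `I` in a subsystem `T`:
`C_T(I) = {x ∈ T : [x,I,T] = [T,I,x] = 0}`. -/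
def relCentralizer (L : LTSStruct F S) (T : Submodule F S) (I : Set S) : Set S :=
  {x | x ∈ T ∧ (∀ i ∈ I, ∀ t ∈ T, L.b x i t = 0) ∧ (∀ t ∈ T, ∀ i ∈ I, L.b t i x = 0)}

/-- The center `C(S) = {x ∈ S : [x,S,S] = 0}`. -/
def center (L : LTSStruct F S) : Set S := {x | ∀ y z : S, L.b x y z = 0}

/-- The center of a subsystem `T`: `C(T) = {x ∈ T : [x,T,T] = 0}`. -/
def relCenter (L : LTSStruct F S) (T : Submodule F S) : Set S :=
  {x | x ∈ T ∧ ∀ y ∈ T, ∀ z ∈ T, L.b x y z = 0}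

/-- `S` is semiprime: `[S,I,I] ≠ 0` for every nonzero ideal `I`. -/
def IsSemiprime (L : LTSStruct F S) : Prop :=
  ∀ I : Submodule F S, L.IsIdeal I → I ≠ ⊥ → ∃ t : S, ∃ i ∈ I, ∃ j ∈ I, L.b t i j ≠ 0

/-- `S` is prime: `[S,I,J] ≠ 0` for all nonzero ideals `I`, `J`. -/
def IsPrime (L : LTSStruct F S) : Prop :=
  ∀ I J : Submodule F S, L.IsIdeal I → L.IsIdeal J → I ≠ ⊥ → J ≠ ⊥ →
    ∃ t : S, ∃ i ∈ I, ∃ j ∈ J, L.b t i j ≠ 0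

/-- `S` is nondegenerate: `[S,x,x] ≠ 0` for every nonzero `x`. -/
def IsNondegenerate (L : LTSStruct F S) : Prop :=
  ∀ x : S, x ≠ 0 → ∃ t : S, L.b t x x ≠ 0

/-- A subsystem `T` is semiprime: `[T,I,I] ≠ 0` for every nonzero ideal `I` of `T`. -/
def RelSemiprime (L : LTSStruct F S) (T : Submodule F S) : Prop :=
  ∀ I : Submodule F S, L.IsIdealOf I T → I ≠ ⊥ → ∃ t ∈ T, ∃ i ∈ I, ∃ j ∈ I, L.b t i j ≠ 0

/-- A subsystem `T` is prime: `[T,I,J] ≠ 0` for all nonzero ideals `I`, `J` of `T`. -/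
def RelPrime (L : LTSStruct F S) (T : Submodule F S) : Prop :=
  ∀ I J : Submodule F S, L.IsIdealOf I T → L.IsIdealOf J T → I ≠ ⊥ → J ≠ ⊥ →
    ∃ t ∈ T, ∃ i ∈ I, ∃ j ∈ J, L.b t i j ≠ 0

/-- A subsystem `T` is nondegenerate: `[T,x,x] ≠ 0` for every nonzero `x ∈ T`. -/
def RelNondegenerate (L : LTSStruct F S) (T : Submodule F S) : Prop :=
  ∀ x ∈ T, x ≠ 0 → ∃ t ∈ T, L.b t x x ≠ 0

/-- An ideal `I` of `S` is essential if it hits every nonzero ideal of `S`. -/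
def IsEssentialIdeal (L : LTSStruct F S) (I : Submodule F S) : Prop :=
  L.IsIdeal I ∧ ∀ J : Submodule F S, L.IsIdeal J → J ≠ ⊥ → I ⊓ J ≠ ⊥

/-- An ideal `I` of the subsystem `T` is essential in `T` if it hits every
nonzero ideal of `T`. -/
def IsEssentialIdealOf (L : LTSStruct F S) (I T : Submodule F S) : Prop :=
  L.IsIdealOf I T ∧ ∀ J : Submodule F S, L.IsIdealOf J T → J ≠ ⊥ → I ⊓ J ≠ ⊥

/-- The elements `s`, `R(x₁,y₁)⋯R(xₙ,yₙ)(s)` with all `xᵢ, yᵢ ∈ T`, where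
`R(x,y)(z) = [z,x,y]`. -/
inductive InIter (L : LTSStruct F S) (T : Submodule F S) (s : S) : S → Prop
  | base : InIter L T s s
  | step (z x y : S) : InIter L T s z → x ∈ T → y ∈ T → InIter L T s (L.b z x y)

/-- `_T(s)`: the linear span in `S` of `s` and all `R(x₁,y₁)⋯R(xₙ,yₙ)(s)`,
`xᵢ, yᵢ ∈ T`. -/
def innerIdeal (L : LTSStruct F S) (T : Submodule F S) (s : S) : Submodule F S :=
  Submodule.span F {z | InIter L T s z}

/-- `(T:s) = {x ∈ T : [x,T,_T(s)] + [x,_T(s),T] ⊆ T}`. -/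
def quotSet (L : LTSStruct F S) (T : Submodule F S) (s : S) : Set S :=
  {x | x ∈ T ∧ ∀ t ∈ T, ∀ u ∈ L.innerIdeal T s, L.b x t u ∈ T ∧ L.b x u t ∈ T}

/-- `S` is a system of quotients of `T`. -/
def IsSystemOfQuotients (L : LTSStruct F S) (T : Submodule F S) : Prop :=
  L.IsSubsystem T ∧ ∀ s s' : S, s ≠ 0 →
    ∃ x ∈ T, ∃ y ∈ T, L.b s x y ≠ 0 ∧ (x ∈ L.quotSet T s' ∨ y ∈ L.quotSet T s')

/-- `S` is a weak system of quotients of `T`. -/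
def IsWeakSystemOfQuotients (L : LTSStruct F S) (T : Submodule F S) : Prop :=
  L.IsSubsystem T ∧ ∀ s : S, s ≠ 0 → ∃ x ∈ T, ∃ y ∈ T, L.b s x y ≠ 0 ∧ L.b s x y ∈ T

/-- `S` is ideally absorbed into `T`: for every `0 ≠ s ∈ S` there is an ideal `I`
of `T` with `C_T(I) = 0` and `0 ≠ [s,I,T] + [s,T,I] ⊆ T`. -/
def IsIdeallyAbsorbed (L : LTSStruct F S) (T : Submodule F S) : Prop :=
  L.IsSubsystem T ∧ ∀ s : S, s ≠ 0 → ∃ I : Submodule F S, L.IsIdealOf I T ∧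
    L.relCentralizer T (I : Set S) = {0} ∧
    (∃ i ∈ I, ∃ t ∈ T, L.b s i t ≠ 0 ∨ L.b s t i ≠ 0) ∧
    (∀ i ∈ I, ∀ t ∈ T, L.b s i t ∈ T ∧ L.b s t i ∈ T)

end LTSStruct

namespace LTSStruct

variable {F : Type*} [Field F] {S : Type*} [AddCommGroup S] [Module F S]

theorem skew (L : LTSStruct F S) (x y z : S) : L.b x y z = -L.b y x z := by
  have h := L.alt (x + y) z
  rw [L.add₁, L.add₂, L.add₂, L.alt, L.alt, zero_add, add_zero] at h
  exact eq_neg_of_add_eq_zero_left h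

theorem skew_mem (L : LTSStruct F S) {T : Submodule F S} {x y z : S} (h : L.b x y z ∈ T) :
    L.b y x z ∈ T := by
  rw [L.skew]
  exact T.neg_mem h

theorem cyclic_mem (L : LTSStruct F S) {T : Submodule F S} {x y z : S}
    (h₁ : L.b x y z ∈ T) (h₂ : L.b y z x ∈ T) : L.b z x y ∈ T := by
  rw [← neg_eq_of_add_eq_zero_right (L.cyclic x y z)]
  exact T.neg_mem (T.add_mem h₁ h₂)

theorem zero₁ (L : LTSStruct F S) (y z : S) : L.b 0 y z = 0 := by
  simpa using L.smul₁ 0 0 y z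

theorem zero₂ (L : LTSStruct F S) (x z : S) : L.b x 0 z = 0 := by
  simpa using L.smul₂ 0 x 0 z

theorem zero₃ (L : LTSStruct F S) (x y : S) : L.b x y 0 = 0 := by
  simpa using L.smul₃ 0 x y 0

/-- Membership form of the commutator identity
`D([u,v,x],y) = [D(u,v), D(x,y)] - D(x,[u,v,y])`, where `D(a,c) = [a,c,·]`. -/
theorem leibniz_mem (L : LTSStruct F S) {T : Submodule F S} {u v x y z : S}
    (h₁ : L.b u v (L.b x y z) ∈ T) (h₂ : L.b x (L.b u v y) z ∈ T)
    (h₃ : L.b x y (L.b u v z) ∈ T) : L.b (L.b u v x) y z ∈ T := by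
  have h := L.leibniz u v x y z
  have e : L.b (L.b u v x) y z =
      L.b u v (L.b x y z) - L.b x (L.b u v y) z - L.b x y (L.b u v z) := by
    rw [h]; abel
  rw [e]
  exact T.sub_mem (T.sub_mem h₁ h₂) h₃

theorem innerIdeal_mul_mem (L : LTSStruct F S) (T : Submodule F S) (s : S) {u x y : S}
    (hu : u ∈ L.innerIdeal T s) (hx : x ∈ T) (hy : y ∈ T) :
    L.b u x y ∈ L.innerIdeal T s := by
  induction hu using Submodule.span_induction with
  | mem z hz => exact Submodule.subset_span (InIter.step z x y hz hx hy)
  | zero => rw [L.zero₁]; exact Submodule.zero_mem _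
  | add a c _ _ ha hc => rw [L.add₁]; exact Submodule.add_mem _ ha hc
  | smul c a _ ha => rw [L.smul₁]; exact Submodule.smul_mem _ c ha

/-- The set `(T:s)` as a subspace. -/
def quotSubmodule (L : LTSStruct F S) (T : Submodule F S) (s : S) : Submodule F S where
  carrier := L.quotSet T s
  zero_mem' := ⟨T.zero_mem, fun t _ u _ => by
    rw [L.zero₁, L.zero₁]; exact ⟨T.zero_mem, T.zero_mem⟩⟩
  add_mem' := fun ha hc => ⟨T.add_mem ha.1 hc.1, fun t ht u hu => by
    rw [L.add₁, L.add₁]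
    exact ⟨T.add_mem (ha.2 t ht u hu).1 (hc.2 t ht u hu).1,
      T.add_mem (ha.2 t ht u hu).2 (hc.2 t ht u hu).2⟩⟩
  smul_mem' := fun c x hx => ⟨T.smul_mem c hx.1, fun t ht u hu => by
    rw [L.smul₁, L.smul₁]
    exact ⟨T.smul_mem c (hx.2 t ht u hu).1, T.smul_mem c (hx.2 t ht u hu).2⟩⟩

theorem quotSubmodule_isIdealOf (L : LTSStruct F S) {T : Submodule F S}
    (hT : L.IsSubsystem T) (s : S) : L.IsIdealOf (L.quotSubmodule T s) T := by
  refine ⟨fun x hx => hx.1, ?_⟩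
  rintro x ⟨hxT, hx⟩ y hy z hz
  have hU₁ {u a c : S} (hu : u ∈ L.innerIdeal T s) (ha : a ∈ T) (hc : c ∈ T) :
      L.b u a c ∈ L.innerIdeal T s := L.innerIdeal_mul_mem T s hu ha hc
  have hxtu {t u : S} (ht : t ∈ T) (hu : u ∈ L.innerIdeal T s) : L.b x t u ∈ T :=
    (hx t ht u hu).1
  have hxut {t u : S} (ht : t ∈ T) (hu : u ∈ L.innerIdeal T s) : L.b x u t ∈ T :=
    (hx t ht u hu).2
  have hutx {t u : S} (ht : t ∈ T) (hu : u ∈ L.innerIdeal T s) : L.b u t x ∈ T :=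
    L.cyclic_mem (L.skew_mem (hxtu ht hu)) (hxut ht hu)
  have hutw {a c t u : S} (ha : a ∈ T) (hc : c ∈ T) (ht : t ∈ T)
      (hu : u ∈ L.innerIdeal T s) : L.b u t (L.b x a c) ∈ T := by
    rw [L.leibniz]
    exact T.add_mem (T.add_mem (hT _ (hutx ht hu) _ ha _ hc) (hxut hc (hU₁ hu ht ha)))
      (hxtu ha (hU₁ hu ht hc))
  have hwut {a c t u : S} (ha : a ∈ T) (hc : c ∈ T) (ht : t ∈ T)
      (hu : u ∈ L.innerIdeal T s) : L.b (L.b x a c) u t ∈ T :=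
    L.leibniz_mem (hxtu ha (L.skew_mem (hU₁ hu hc ht)))
      (hT _ hc _ (hxtu ha hu) _ ht) (L.skew_mem (hutw ha ht hc hu))
  exact ⟨hT _ hxT _ hy _ hz, fun t ht u hu =>
    ⟨L.skew_mem (L.cyclic_mem (hwut hy hz ht hu) (hutw hy hz ht hu)), hwut hy hz ht hu⟩⟩

theorem IsIdealOf.subset_quotSet {L : LTSStruct F S} {T I : Submodule F S}
    (hI : L.IsIdealOf I T) (hT : L.IsSubsystem T) {s : S}
    (hs : ∀ x ∈ I, ∀ t ∈ T, L.b x t s ∈ T ∧ L.b x s t ∈ T) :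
    (I : Set S) ⊆ L.quotSet T s := by
  have key (u : S) (hu : InIter L T s u) :
      ∀ x ∈ I, ∀ t ∈ T, L.b x t u ∈ T ∧ L.b x u t ∈ T := by
    induction hu with
    | base => exact hs
    | step u a c _ ha hc ih =>
      have huti {i t : S} (hi : i ∈ I) (ht : t ∈ T) : L.b u t i ∈ T :=
        L.cyclic_mem (L.skew_mem (ih i hi t ht).1) (ih i hi t ht).2
      have hxt {x t a c : S} (hx : x ∈ I) (ht : t ∈ T) (ha : a ∈ T) (hc : c ∈ T) :
          L.b x t (L.b u a c) ∈ T := by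
        rw [L.leibniz]
        exact T.add_mem (T.add_mem (hT _ (ih x hx t ht).1 _ ha _ hc)
          (L.skew_mem (ih _ (hI.2 x hx t ht a ha) c hc).2)) (huti (hI.2 x hx t ht c hc) ha)
      exact fun x hx t ht => ⟨hxt hx ht ha hc, L.skew_mem (L.leibniz_mem
        (huti (L.skew_mem (hI.2 x hx c hc t ht)) ha) (hT _ hc _ (huti hx ha) _ ht)
        (L.skew_mem (hxt hx hc ha ht)))⟩
  refine fun x hx => ⟨hI.1 hx, fun t ht u hu => ?_⟩
  induction hu using Submodule.span_induction with
  | mem z hz => exact key z hz x hx t ht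
  | zero => rw [L.zero₂, L.zero₃]; exact ⟨T.zero_mem, T.zero_mem⟩
  | add a c _ _ ha hc =>
    rw [L.add₂, L.add₃]
    exact ⟨T.add_mem ha.1 hc.1, T.add_mem ha.2 hc.2⟩
  | smul c a _ ha =>
    rw [L.smul₂, L.smul₃]
    exact ⟨T.smul_mem c ha.1, T.smul_mem c ha.2⟩

end LTSStruct

/-- `(T:s)` is an ideal of `T`, maximal among ideals `I` of `T`
with `[I,T,s] + [I,s,T] ⊆ T`. -/
theorem quotSet_isIdeal_and_maximal
    {F S : Type*} [Field F] [AddCommGroup S] [Module F S]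
    (L : LTSStruct F S) (T : Submodule F S) (hT : L.IsSubsystem T) (s : S) :
    ∃ Q : Submodule F S, (Q : Set S) = L.quotSet T s ∧ L.IsIdealOf Q T ∧
      ∀ I : Submodule F S, L.IsIdealOf I T →
        (∀ x ∈ I, ∀ t ∈ T, L.b x t s ∈ T ∧ L.b x s t ∈ T) →
        (I : Set S) ⊆ L.quotSet T s := by
  exact ⟨L.quotSubmodule T s, rfl, L.quotSubmodule_isIdealOf hT s,
    fun _ hI hs => hI.subset_quotSet hT hs⟩
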